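/- Let b > 0, δ > 0, η > 0 be real constants and let v satisfy 0 ≤ v < (√5 − 1)/2. Let y : [0,1] × [0,∞) → ℝ be a sufficiently smooth (of class C³) solution of the PDE y_tt + 2δ y_t + 2v y_xt = (1 − v² + (3/2) b y_x²) y_xx + 2η y_x y_xx y_xt + η y_x² y_xxt on (0,1) × [0,∞) with boundary conditions y(0,t) = y(1,t) = 0 for all t ≥ 0. Define V(t) = ∫₀¹ [ (1/2) y_t² + (1/2)(1−v²) y_x² + (b/8) y_x⁴ ] dx + δ ∫₀¹ [ y y_t + δ y² + (η/4) y_x⁴ ] dx and K = 1 + δ · max{ (1 + 2δ/π)/(π(1 − v²)), 2η/b }. Then t ↦ V(t) is differentiable on [0,∞) and for every t ≥ 0, V′(t) ≤ −[2δ(1 − v − v²)/(K(1 − v²))] · V(t). -/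

import Mathlib

open Real

/-- Partial derivative with respect to the first (spatial) variable. -/
noncomputable def pdx (y : ℝ → ℝ → ℝ) (x t : ℝ) : ℝ := deriv (fun x' => y x' t) x

/-- Partial derivative with respect to the second (time) variable. -/
noncomputable def pdt (y : ℝ → ℝ → ℝ) (x t : ℝ) : ℝ := deriv (fun t' => y x t') t

/-- A jointly differentiable function is differentiable in its first variable. -/
theorem hasDerivAt_pdx {f : ℝ → ℝ → ℝ} (hf : Differentiable ℝ (Function.uncurry f)) (x t : ℝ) :
    HasDerivAt (fun x' => f x' t) (pdx f x t) x := by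
  have h : Differentiable ℝ (fun x' : ℝ => Function.uncurry f (x', t)) := by fun_prop
  exact (h x).hasDerivAt

/-- A jointly differentiable function is differentiable in its second variable. -/
theorem hasDerivAt_pdt {f : ℝ → ℝ → ℝ} (hf : Differentiable ℝ (Function.uncurry f)) (x t : ℝ) :
    HasDerivAt (fun t' => f x t') (pdt f x t) t := by
  have h : Differentiable ℝ (fun t' : ℝ => Function.uncurry f (x, t')) := by fun_prop
  exact (h t).hasDerivAt

theorem pdx_eq_fderiv {f : ℝ → ℝ → ℝ} (hf : Differentiable ℝ (Function.uncurry f)) (x t : ℝ) :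
    pdx f x t = fderiv ℝ (Function.uncurry f) (x, t) (1, 0) := by
  have h1 : HasDerivAt (fun x' : ℝ => (x', t)) ((1 : ℝ), (0 : ℝ)) x :=
    (hasDerivAt_id x).prodMk (hasDerivAt_const x t)
  exact ((hf (x, t)).hasFDerivAt.comp_hasDerivAt x h1).deriv

theorem pdt_eq_fderiv {f : ℝ → ℝ → ℝ} (hf : Differentiable ℝ (Function.uncurry f)) (x t : ℝ) :
    pdt f x t = fderiv ℝ (Function.uncurry f) (x, t) (0, 1) := by
  have h1 : HasDerivAt (fun t' : ℝ => (x, t')) ((0 : ℝ), (1 : ℝ)) t :=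
    (hasDerivAt_const t x).prodMk (hasDerivAt_id t)
  exact ((hf (x, t)).hasFDerivAt.comp_hasDerivAt t h1).deriv

theorem contDiff_pdx {f : ℝ → ℝ → ℝ} {n m : WithTop ℕ∞} (hf : ContDiff ℝ n (Function.uncurry f))
    (hmn : m + 1 ≤ n) : ContDiff ℝ m (Function.uncurry (pdx f)) := by
  have hd : Differentiable ℝ (Function.uncurry f) :=
    (hf.of_le (le_trans le_add_self hmn)).differentiable one_ne_zero
  have h : Function.uncurry (pdx f) =
      fun p : ℝ × ℝ => fderiv ℝ (Function.uncurry f) p (1, 0) := by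
    funext ⟨x, t⟩
    exact pdx_eq_fderiv hd x t
  rw [h]
  exact (hf.fderiv_right hmn).clm_apply contDiff_const

theorem contDiff_pdt {f : ℝ → ℝ → ℝ} {n m : WithTop ℕ∞} (hf : ContDiff ℝ n (Function.uncurry f))
    (hmn : m + 1 ≤ n) : ContDiff ℝ m (Function.uncurry (pdt f)) := by
  have hd : Differentiable ℝ (Function.uncurry f) :=
    (hf.of_le (le_trans le_add_self hmn)).differentiable one_ne_zero
  have h : Function.uncurry (pdt f) =
      fun p : ℝ × ℝ => fderiv ℝ (Function.uncurry f) p (0, 1) := by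
    funext ⟨x, t⟩
    exact pdt_eq_fderiv hd x t
  rw [h]
  exact (hf.fderiv_right hmn).clm_apply contDiff_const

/-- Mixed second partial derivatives of a `C²` function commute. -/
theorem pdt_pdx_comm {f : ℝ → ℝ → ℝ} (hf : ContDiff ℝ 2 (Function.uncurry f)) (x t : ℝ) :
    pdt (pdx f) x t = pdx (pdt f) x t := by
  have h12 : (1 : WithTop ℕ∞) + 1 ≤ 2 := by norm_num
  have hd : Differentiable ℝ (Function.uncurry f) := hf.differentiable two_ne_zero
  have hdd : Differentiable ℝ (fderiv ℝ (Function.uncurry f)) :=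
    (hf.fderiv_right h12).differentiable one_ne_zero
  have hx : Function.uncurry (pdx f) =
      fun p : ℝ × ℝ => fderiv ℝ (Function.uncurry f) p (1, 0) := by
    funext ⟨x, t⟩
    exact pdx_eq_fderiv hd x t
  have ht : Function.uncurry (pdt f) =
      fun p : ℝ × ℝ => fderiv ℝ (Function.uncurry f) p (0, 1) := by
    funext ⟨x, t⟩
    exact pdt_eq_fderiv hd x t
  have key : ∀ u w : ℝ × ℝ, fderiv ℝ (fun p => fderiv ℝ (Function.uncurry f) p u) (x, t) w =
      fderiv ℝ (fderiv ℝ (Function.uncurry f)) (x, t) w u := by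
    intro u w
    rw [((hdd (x, t)).hasFDerivAt.clm_apply (hasFDerivAt_const u (x, t))).fderiv]
    simp
  rw [pdt_eq_fderiv ((contDiff_pdx hf h12).differentiable one_ne_zero),
    pdx_eq_fderiv ((contDiff_pdt hf h12).differentiable one_ne_zero), hx, ht, key, key]
  exact hf.contDiffAt.isSymmSndFDerivAt (by simp) _ _

/-- Differentiation under the integral sign for `C¹` integrands on a compact interval. -/
theorem hasDerivAt_integral_pdt {f : ℝ → ℝ → ℝ} (hf : ContDiff ℝ 1 (Function.uncurry f))
    (a b t : ℝ) :
    HasDerivAt (fun s => ∫ x in a..b, f x s) (∫ x in a..b, pdt f x t) t := by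
  have hc : Continuous (Function.uncurry (pdt f)) :=
    (contDiff_pdt (m := 0) hf (by simp)).continuous
  have hfc : Continuous (Function.uncurry f) := hf.continuous
  have hsec : ∀ s, Continuous fun x => f x s := fun s =>
    hfc.comp (continuous_id.prodMk continuous_const)
  have hsec' : ∀ s, Continuous fun x => pdt f x s := fun s =>
    hc.comp (continuous_id.prodMk continuous_const)
  obtain ⟨C, hC⟩ := (isCompact_uIcc (a := a) (b := b)).prod
    (isCompact_Icc (a := t - 1) (b := t + 1)) |>.exists_bound_of_continuousOn hc.continuousOn
  refine (intervalIntegral.hasDerivAt_integral_of_dominated_loc_of_deriv_le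
    (F := fun s x => f x s) (F' := fun s x => pdt f x s) (bound := fun _ => C)
    (s := Set.Icc (t - 1) (t + 1)) (Icc_mem_nhds (by linarith) (by linarith))
    (Filter.Eventually.of_forall fun s => (hsec s).aestronglyMeasurable)
    ((hsec t).intervalIntegrable _ _) (hsec' t).aestronglyMeasurable
    (Filter.Eventually.of_forall fun x hx s hs => ?_) intervalIntegrable_const
    (Filter.Eventually.of_forall fun x _ s _ =>
      hasDerivAt_pdt (hf.differentiable one_ne_zero) x s)).2
  exact hC (x, s) ⟨Set.uIoc_subset_uIcc hx, hs⟩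

/-- Wirtinger's inequality with a constant below the optimal one. -/
theorem sq_mul_integral_sq_le_of_lt_pi {f f' : ℝ → ℝ} (hf : ∀ x, HasDerivAt f (f' x) x)
    (hf' : Continuous f') (h0 : f 0 = 0) (h1 : f 1 = 0) {c : ℝ} (hc0 : 0 ≤ c) (hc : c < π) :
    c ^ 2 * ∫ x in (0:ℝ)..1, f x ^ 2 ≤ ∫ x in (0:ℝ)..1, f' x ^ 2 := by
  have hfc : Continuous f := continuous_iff_continuousAt.2 fun x => (hf x).continuousAt
  have hcos : ∀ x ∈ Set.Icc (0:ℝ) 1, cos (c * (x - 1 / 2)) ≠ 0 := fun x hx =>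
    (cos_pos_of_mem_Ioo ⟨by nlinarith [hx.1, hx.2], by nlinarith [hx.1, hx.2]⟩).ne'
  set T : ℝ → ℝ := fun x => tan (c * (x - 1 / 2)) with hT
  have hTd : ∀ x ∈ Set.Icc (0:ℝ) 1, HasDerivAt T (c * (1 + T x ^ 2)) x := by
    intro x hx
    have hl : HasDerivAt (fun x : ℝ => c * (x - 1 / 2)) (c * 1) x :=
      ((hasDerivAt_id x).sub_const _).const_mul c
    refine ((hasDerivAt_tan (hcos x hx)).comp x hl).congr_deriv ?_
    rw [one_div, ← inv_one_add_tan_sq (hcos x hx), inv_inv]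
    ring
  have hTc : ContinuousOn T (Set.Icc 0 1) := fun x hx =>
    (hTd x hx).continuousAt.continuousWithinAt
  have hGd : ∀ x ∈ Set.Icc (0:ℝ) 1, HasDerivAt (fun x => c * T x * f x ^ 2)
      (c ^ 2 * (1 + T x ^ 2) * f x ^ 2 + 2 * c * T x * f x * f' x) x := by
    intro x hx
    refine (((hTd x hx).const_mul c).mul ((hf x).pow 2)).congr_deriv ?_
    simp only [Pi.pow_apply]
    push_cast
    ring
  have hi : ∀ g : ℝ → ℝ, ContinuousOn g (Set.Icc 0 1) →
      IntervalIntegrable g MeasureTheory.volume 0 1 := fun g hg =>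
    ContinuousOn.intervalIntegrable (by rwa [Set.uIcc_of_le zero_le_one])
  have hGi := hi (fun x => c ^ 2 * (1 + T x ^ 2) * f x ^ 2 + 2 * c * T x * f x * f' x)
    (by fun_prop)
  have hG := intervalIntegral.integral_eq_sub_of_hasDerivAt
    (fun x hx => hGd x (by rwa [Set.uIcc_of_le zero_le_one] at hx)) hGi
  rw [h0, h1] at hG
  have hmono : ∫ x in (0:ℝ)..1, (c ^ 2 * f x ^ 2 -
      (c ^ 2 * (1 + T x ^ 2) * f x ^ 2 + 2 * c * T x * f x * f' x)) ≤
      ∫ x in (0:ℝ)..1, f' x ^ 2 := by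
    refine intervalIntegral.integral_mono_on zero_le_one (hi _ (by fun_prop)) (hi _ (by fun_prop))
      fun x _ => ?_
    nlinarith [sq_nonneg (f' x + c * T x * f x)]
  rw [intervalIntegral.integral_sub (hi _ (by fun_prop)) hGi, hG,
    intervalIntegral.integral_const_mul] at hmono
  linarith

/-- **Wirtinger's inequality** on `[0, 1]` with Dirichlet boundary conditions. -/
theorem pi_sq_mul_integral_sq_le {f f' : ℝ → ℝ} (hf : ∀ x, HasDerivAt f (f' x) x)
    (hf' : Continuous f') (h0 : f 0 = 0) (h1 : f 1 = 0) :
    π ^ 2 * ∫ x in (0:ℝ)..1, f x ^ 2 ≤ ∫ x in (0:ℝ)..1, f' x ^ 2 := by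
  have ht : Filter.Tendsto (fun c : ℝ => c ^ 2 * ∫ x in (0:ℝ)..1, f x ^ 2)
      (nhdsWithin π (Set.Iio π)) (nhds (π ^ 2 * ∫ x in (0:ℝ)..1, f x ^ 2)) :=
    Filter.Tendsto.mono_left (Continuous.tendsto (by fun_prop) π) nhdsWithin_le_nhds
  refine le_of_tendsto ht ?_
  filter_upwards [Ioo_mem_nhdsLT pi_pos] with c hc
  exact sq_mul_integral_sq_le_of_lt_pi hf hf' h0 h1 hc.1.le hc.2

/-- Pointwise bound of the dissipation form by the energy density. -/
theorem dissipation_le {b δ η v r p q w : ℝ} (hb : 0 ≤ b) (hδ : 0 ≤ δ) (hη : 0 ≤ η) (hv0 : 0 ≤ v)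
    (hv2 : 0 < 1 - v ^ 2) (hr : r = 2 * δ * (1 - v - v ^ 2) / (1 - v ^ 2)) :
    -δ * q ^ 2 - η * p ^ 2 * w ^ 2 + 2 * v * δ * (p * q) - δ * (1 - v ^ 2) * p ^ 2
      - δ * b / 2 * p ^ 4 ≤
    -r * ((1/2) * q ^ 2 + (1/2) * (1 - v ^ 2) * p ^ 2 + (b/8) * p ^ 4) := by
  have hrv : r * (1 - v ^ 2) = 2 * δ * (1 - v - v ^ 2) := by
    rw [hr]
    field_simp
  have hr1 : r ≤ 2 * δ * (1 - v) := by
    rw [hr, div_le_iff₀ hv2]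
    have : 0 ≤ δ * v ^ 3 := by positivity
    nlinarith
  have hr2 : r ≤ 2 * δ := by nlinarith
  have h1 := mul_nonneg (sub_nonneg.2 hr1) (sq_nonneg q)
  have h2 := mul_nonneg (mul_nonneg (sub_nonneg.2 hr2) hb) (sq_nonneg (p ^ 2))
  have h3 := mul_nonneg (mul_nonneg hδ hv0) (sq_nonneg (p - q))
  have h4 := mul_nonneg hη (sq_nonneg (p * w))
  have h5 := mul_nonneg (mul_nonneg hδ hb) (sq_nonneg (p ^ 2))
  have h6 : r * (1 - v ^ 2) * p ^ 2 = 2 * δ * (1 - v - v ^ 2) * p ^ 2 := by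
    rw [hrv]
  nlinarith

/-- Pointwise bound of the Lyapunov density by the energy density, up to a Wirtinger defect. -/
theorem lyapunov_density_le {b δ η v m u p q : ℝ} (hb : 0 < b) (hδ : 0 ≤ δ)
    (hv2 : 0 < 1 - v ^ 2) (hm1 : (1 + 2 * δ / π) / (π * (1 - v ^ 2)) ≤ m) (hm2 : 2 * η / b ≤ m) :
    ((1/2) * q ^ 2 + (1/2) * (1 - v ^ 2) * p ^ 2 + (b/8) * p ^ 4)
      + δ * (u * q + δ * u ^ 2 + (η/4) * p ^ 4)
      - δ * (1 / (2 * π) + δ / π ^ 2) * (π ^ 2 * u ^ 2 - p ^ 2) ≤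
    (1 + δ * m) * ((1/2) * q ^ 2 + (1/2) * (1 - v ^ 2) * p ^ 2 + (b/8) * p ^ 4) := by
  have hm3 : 1 / π + 2 * δ / π ^ 2 ≤ m * (1 - v ^ 2) := by
    rw [div_le_iff₀ (by positivity)] at hm1
    have : 1 / π + 2 * δ / π ^ 2 = (1 + 2 * δ / π) / π := by field_simp
    rw [this, div_le_iff₀ pi_pos]
    linarith
  have hm4 : 1 / π ≤ m := by
    have h1 : 0 ≤ 2 * δ / π ^ 2 := by positivity
    have hm0 : 0 ≤ m := le_trans (by positivity) hm1
    have h2 := mul_nonneg hm0 (sq_nonneg v)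
    linarith
  rw [div_le_iff₀ hb] at hm2
  have hyq : u * q ≤ π / 2 * u ^ 2 + 1 / π / 2 * q ^ 2 := by
    have h : π / 2 * u ^ 2 + 1 / π / 2 * q ^ 2 - u * q
        = (π * u - q) ^ 2 / (2 * π) := by
      field_simp
      ring
    have : 0 ≤ (π * u - q) ^ 2 / (2 * π) := by positivity
    linarith
  have hexp : δ * (1 / (2 * π) + δ / π ^ 2) * (π ^ 2 * u ^ 2 - p ^ 2)
      = δ * (π / 2 * u ^ 2 + δ * u ^ 2
        - (1 / π + 2 * δ / π ^ 2) * p ^ 2 / 2) := by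
    field_simp
  have key : u * q + δ * u ^ 2 + η / 4 * p ^ 4
      - (π / 2 * u ^ 2 + δ * u ^ 2
        - (1 / π + 2 * δ / π ^ 2) * p ^ 2 / 2) ≤
      m * ((1/2) * q ^ 2 + (1/2) * (1 - v ^ 2) * p ^ 2 + (b/8) * p ^ 4) := by
    have h1 := mul_nonneg (sub_nonneg.2 hm4) (sq_nonneg q)
    have h2 := mul_nonneg (sub_nonneg.2 hm3) (sq_nonneg p)
    have h3 := mul_nonneg (sub_nonneg.2 hm2) (sq_nonneg (p ^ 2))
    linarith
  rw [hexp]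
  linarith [mul_le_mul_of_nonneg_left key hδ]

/-- Along C³ solutions of the Kelvin–Voigt moving-string PDE with subcritical
speed `v < (√5 − 1)/2`, the Lyapunov function `V` satisfies the differential
inequality `V′(t) ≤ −[2δ(1 − v − v²)/(K(1 − v²))] V(t)`. -/
theorem stmt_13 (b δ η v : ℝ) (hb : 0 < b) (hδ : 0 < δ) (hη : 0 < η)
    (hv0 : 0 ≤ v) (hv1 : v < (Real.sqrt 5 - 1) / 2)
    (y : ℝ → ℝ → ℝ)
    (hy : ContDiff ℝ 3 (Function.uncurry y))
    (hpde : ∀ x ∈ Set.Ioo (0:ℝ) 1, ∀ t : ℝ, 0 ≤ t →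
      pdt (pdt y) x t + 2 * δ * pdt y x t + 2 * v * pdx (pdt y) x t
        = (1 - v ^ 2 + (3/2) * b * (pdx y x t) ^ 2) * pdx (pdx y) x t
          + 2 * η * pdx y x t * pdx (pdx y) x t * pdx (pdt y) x t
          + η * (pdx y x t) ^ 2 * pdx (pdx (pdt y)) x t)
    (hbc : ∀ t : ℝ, 0 ≤ t → y 0 t = 0 ∧ y 1 t = 0)
    (V : ℝ → ℝ)
    (hV : ∀ t : ℝ, V t =
      (∫ x in (0:ℝ)..1,
        ((1/2) * (pdt y x t) ^ 2 + (1/2) * (1 - v ^ 2) * (pdx y x t) ^ 2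
          + (b/8) * (pdx y x t) ^ 4))
      + δ * ∫ x in (0:ℝ)..1,
        (y x t * pdt y x t + δ * (y x t) ^ 2 + (η/4) * (pdx y x t) ^ 4))
    (K : ℝ)
    (hK : K = 1 + δ * max ((1 + 2 * δ / π) / (π * (1 - v ^ 2))) (2 * η / b)) :
    ∀ t : ℝ, 0 ≤ t → DifferentiableAt ℝ V t ∧
      deriv V t ≤ -(2 * δ * (1 - v - v ^ 2) / (K * (1 - v ^ 2))) * V t := by
  intro t ht
  have h5 : Real.sqrt 5 ^ 2 = 5 := Real.sq_sqrt (by norm_num)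
  have h5' : 0 ≤ Real.sqrt 5 := Real.sqrt_nonneg 5
  have hc : 0 < 1 - v - v ^ 2 := by nlinarith
  have hv2 : 0 < 1 - v ^ 2 := by linarith
  have hv1' : v < 1 := by nlinarith
  have hq : ContDiff ℝ 2 (Function.uncurry (pdt y)) := contDiff_pdt hy (by norm_num)
  have hp : ContDiff ℝ 2 (Function.uncurry (pdx y)) := contDiff_pdx hy (by norm_num)
  have hqx : ContDiff ℝ 1 (Function.uncurry (pdx (pdt y))) := contDiff_pdx hq (by norm_num)
  have hqt : ContDiff ℝ 1 (Function.uncurry (pdt (pdt y))) := contDiff_pdt hq (by norm_num)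
  have hy1 : ContDiff ℝ 1 (Function.uncurry y) := hy.of_le (by norm_num)
  have hq1 : ContDiff ℝ 1 (Function.uncurry (pdt y)) := hq.of_le (by norm_num)
  have hp1 : ContDiff ℝ 1 (Function.uncurry (pdx y)) := hp.of_le (by norm_num)
  have hyd := hy1.differentiable one_ne_zero
  have hqd := hq1.differentiable one_ne_zero
  have hpd := hp1.differentiable one_ne_zero
  have hqxd := hqx.differentiable one_ne_zero
  have hsec : ∀ {f : ℝ → ℝ → ℝ} (s : ℝ), ContDiff ℝ 1 (Function.uncurry f) →
      Continuous fun x => f x s :=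
    fun s hf => hf.continuous.comp (continuous_id.prodMk continuous_const)
  have hyc := hsec t hy1
  have hqc := hsec t hq1
  have hpc := hsec t hp1
  have hqxc := hsec t hqx
  have hqtc := hsec t hqt
  have hii : ∀ {g : ℝ → ℝ}, Continuous g → IntervalIntegrable g MeasureTheory.volume 0 1 :=
    fun hg => hg.intervalIntegrable 0 1
  have hqbc : ∀ x, (∀ s : ℝ, 0 ≤ s → y x s = 0) → pdt y x t = 0 := by
    intro x hx
    have h1 := (hasDerivAt_pdt hyd x t).hasDerivWithinAt (s := Set.Ici 0)
    have h2 : HasDerivWithinAt (fun s => y x s) 0 (Set.Ici 0) t :=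
      (hasDerivWithinAt_const t (Set.Ici 0) (0 : ℝ)).congr (fun s hs => hx s hs) (hx t ht)
    exact (uniqueDiffOn_Ici (0 : ℝ) t ht).eq_deriv _ h1 h2
  have hy0 := (hbc t ht).1
  have hyl := (hbc t ht).2
  have hq0 := hqbc 0 fun s hs => (hbc s hs).1
  have hql := hqbc 1 fun s hs => (hbc s hs).2
  set D : ℝ → ℝ → ℝ := fun x s =>
    ((1/2) * (pdt y x s) ^ 2 + (1/2) * (1 - v ^ 2) * (pdx y x s) ^ 2 + (b/8) * (pdx y x s) ^ 4)
      + δ * (y x s * pdt y x s + δ * (y x s) ^ 2 + (η/4) * (pdx y x s) ^ 4) with hD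
  have hD1 : ContDiff ℝ 1 (Function.uncurry D) := by
    have e : Function.uncurry D = fun z : ℝ × ℝ =>
      ((1/2) * (Function.uncurry (pdt y) z) ^ 2
        + (1/2) * (1 - v ^ 2) * (Function.uncurry (pdx y) z) ^ 2
        + (b/8) * (Function.uncurry (pdx y) z) ^ 4)
      + δ * (Function.uncurry y z * Function.uncurry (pdt y) z + δ * (Function.uncurry y z) ^ 2
        + (η/4) * (Function.uncurry (pdx y) z) ^ 4) := rfl
    rw [e]
    fun_prop
  have hVD : V = fun s => ∫ x in (0:ℝ)..1, D x s := by
    funext s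
    have hyc' := hsec s hy1
    have hqc' := hsec s hq1
    have hpc' := hsec s hp1
    rw [hV s, ← intervalIntegral.integral_const_mul,
      ← intervalIntegral.integral_add (hii (by fun_prop)) (hii (by fun_prop))]
  have hVd : HasDerivAt V (∫ x in (0:ℝ)..1, pdt D x t) t := by
    rw [hVD]
    exact hasDerivAt_integral_pdt hD1 0 1 t
  refine ⟨hVd.differentiableAt, ?_⟩
  have hpdtD : ∀ x, pdt D x t = pdt y x t * pdt (pdt y) x t
      + (1 - v ^ 2) * pdx y x t * pdx (pdt y) x t + b / 2 * pdx y x t ^ 3 * pdx (pdt y) x t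
      + δ * (pdt y x t ^ 2 + y x t * pdt (pdt y) x t + 2 * δ * y x t * pdt y x t
        + η * pdx y x t ^ 3 * pdx (pdt y) x t) := by
    intro x
    have hyt := hasDerivAt_pdt hyd x t
    have hqt' := hasDerivAt_pdt hqd x t
    have hpt := hasDerivAt_pdt hpd x t
    rw [pdt_pdx_comm (hy.of_le (by norm_num))] at hpt
    refine HasDerivAt.deriv (((((hqt'.pow 2).const_mul (1/2)).add
      ((hpt.pow 2).const_mul ((1/2) * (1 - v ^ 2)))).add ((hpt.pow 4).const_mul (b/8))).add
      ((((hyt.mul hqt').add ((hyt.pow 2).const_mul δ)).add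
        ((hpt.pow 4).const_mul (η/4))).const_mul δ) |>.congr_deriv ?_)
    push_cast
    ring
  have hpdtDc : Continuous fun x => pdt D x t := by
    simp only [hpdtD]
    fun_prop
  -- The time derivative of the density is a dissipative form plus an exact `x`-derivative.
  set S : ℝ → ℝ := fun x =>
    (1 - v ^ 2) * pdx y x t + b / 2 * pdx y x t ^ 3 + η * pdx y x t ^ 2 * pdx (pdt y) x t with hS
  set G : ℝ → ℝ := fun x => pdt y x t * S x - v * pdt y x t ^ 2
    + δ * (y x t * S x - 2 * v * (y x t * pdt y x t)) with hG
  set Q : ℝ → ℝ := fun x => -δ * pdt y x t ^ 2 - η * pdx y x t ^ 2 * pdx (pdt y) x t ^ 2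
    + 2 * v * δ * (pdx y x t * pdt y x t) - δ * (1 - v ^ 2) * pdx y x t ^ 2
    - δ * b / 2 * pdx y x t ^ 4 with hQ
  have hGd : ∀ x ∈ Set.Ioo (0:ℝ) 1, HasDerivAt G (pdt D x t - Q x) x := by
    intro x hx
    have hyx := hasDerivAt_pdx hyd x t
    have hqx' := hasDerivAt_pdx hqd x t
    have hpx := hasDerivAt_pdx hpd x t
    have hqxx := hasDerivAt_pdx hqxd x t
    have hSx := ((hpx.const_mul (1 - v ^ 2)).add ((hpx.pow 3).const_mul (b / 2))).add
      (((hpx.pow 2).const_mul η).mul hqxx)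
    refine (((hqx'.mul hSx).sub ((hqx'.pow 2).const_mul v)).add
      (((hyx.mul hSx).sub ((hyx.mul hqx').const_mul (2 * v))).const_mul δ)).congr_deriv ?_
    have h := hpde x hx t ht
    rw [hpdtD x]
    simp only [hQ, Pi.add_apply, Pi.mul_apply, Pi.pow_apply]
    push_cast
    linear_combination (-(pdt y x t) - δ * y x t) * h
  have hQc : Continuous Q := by fun_prop
  have hGc : Continuous G := by fun_prop
  have hint := intervalIntegral.integral_eq_sub_of_hasDerivAt_of_le zero_le_one hGc.continuousOn hGd
    (hii (hpdtDc.sub hQc))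
  have hG0 : G 0 = 0 := by simp [hG, hy0, hq0]
  have hG1 : G 1 = 0 := by simp [hG, hyl, hql]
  rw [intervalIntegral.integral_sub (hii hpdtDc) (hii hQc), hG0, hG1] at hint
  set r : ℝ := 2 * δ * (1 - v - v ^ 2) / (1 - v ^ 2) with hr
  have hr0 : 0 ≤ r := by positivity
  set e : ℝ → ℝ := fun x =>
    (1/2) * (pdt y x t) ^ 2 + (1/2) * (1 - v ^ 2) * (pdx y x t) ^ 2 + (b/8) * (pdx y x t) ^ 4
    with he
  have hec : Continuous e := by fun_prop
  have hQe : ∫ x in (0:ℝ)..1, Q x ≤ -r * ∫ x in (0:ℝ)..1, e x := by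
    rw [← intervalIntegral.integral_const_mul]
    refine intervalIntegral.integral_mono_on zero_le_one (hii hQc) (hii (by fun_prop))
      fun x _ => ?_
    exact dissipation_le hb.le hδ.le hη.le hv0 hv2 hr
  set m : ℝ := max ((1 + 2 * δ / π) / (π * (1 - v ^ 2))) (2 * η / b) with hm
  have hm1 : (1 + 2 * δ / π) / (π * (1 - v ^ 2)) ≤ m := le_max_left _ _
  have hm2 : 2 * η / b ≤ m := le_max_right _ _
  have hm0 : 0 < m := lt_max_of_lt_right (by positivity)
  have hK0 : 0 < K := by rw [hK]; positivity
  have hVe : V t ≤ K * ∫ x in (0:ℝ)..1, e x := by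
    have hW := pi_sq_mul_integral_sq_le (fun x => hasDerivAt_pdx hyd x t) hpc hy0 hyl
    have hb1 : ∫ x in (0:ℝ)..1, (D x t - δ * (1 / (2 * π) + δ / π ^ 2) *
        (π ^ 2 * y x t ^ 2 - pdx y x t ^ 2)) ≤ ∫ x in (0:ℝ)..1, K * e x := by
      refine intervalIntegral.integral_mono_on zero_le_one (hii (by fun_prop)) (hii (by fun_prop))
        fun x _ => ?_
      rw [hK]
      exact lyapunov_density_le hb hδ.le hv2 hm1 hm2
    rw [intervalIntegral.integral_sub (hii (by fun_prop)) (hii (by fun_prop)),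
      intervalIntegral.integral_const_mul, intervalIntegral.integral_const_mul,
      intervalIntegral.integral_sub (hii (by fun_prop)) (hii (by fun_prop)),
      intervalIntegral.integral_const_mul] at hb1
    have hpos : 0 ≤ δ * (1 / (2 * π) + δ / π ^ 2) := by positivity
    rw [hVD]
    nlinarith [mul_nonneg hpos (sub_nonneg.2 hW)]
  rw [hVd.deriv]
  calc ∫ x in (0:ℝ)..1, pdt D x t = ∫ x in (0:ℝ)..1, Q x := by linarith
    _ ≤ -r * ∫ x in (0:ℝ)..1, e x := hQe
    _ ≤ -r * (V t / K) := by
      have : V t / K ≤ ∫ x in (0:ℝ)..1, e x := by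
        rw [div_le_iff₀ hK0]
        linarith
      nlinarith
    _ = _ := by
      rw [hr]
      field_simp
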